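/- Let χ : D₆ → ℂ be the sign character, χ(rᵏ) = 1 and χ(s·rᵏ) = −1 for all k, and let M_χ be the operator on F × F acting by pointwise multiplication by χ in both components: M_χ(f₁, f₂) = (χ·f₁, χ·f₂). Then M_χ² = id and D̸ ∘ M_χ = −M_χ ∘ D̸; consequently, for every λ ∈ ℂ, M_χ maps the λ-eigenspace of D̸ bijectively onto the (−λ)-eigenspace of D̸. -/

import Mathlib

noncomputable section
open DihedralGroup Complex

abbrev D6 := DihedralGroup 6
/-- the reflection `s` -/
def s : D6 := DihedralGroup.sr 0
/-- the rotation `r` of order 6 -/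
def rot : D6 := DihedralGroup.r 1
/-- `t = s*r` -/
def t : D6 := s * rot
/-- `x = s*r^3` -/
def x : D6 := s * rot ^ 3
/-- `y = s*r^5` -/
def y : D6 := s * rot ^ 5
/-- `F` is the space of complex-valued functions on `D₆`. -/
abbrev F := D6 → ℂ

/-- The right-translation operator `(R_a f)(g) = f(g·a)`. -/
def R (a : D6) : Module.End ℂ F := LinearMap.funLeft ℂ ℂ (fun g => g * a)

/-- `ω = exp(iπ/3)`. -/
def ω : ℂ := Complex.exp (Real.pi * Complex.I / 3)

/-- `D₀ = R_t + R_x + R_y`. -/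
def D₀ : Module.End ℂ F := R t + R x + R y

/-- `D₁ = ω·R_t + ω³·R_x + ω⁵·R_y`. -/
def D₁ : Module.End ℂ F := ω • R t + ω ^ 3 • R x + ω ^ 5 • R y

/-- `D₂ = ω⁻¹·R_t + ω⁻³·R_x + ω⁻⁵·R_y`. -/
def D₂ : Module.End ℂ F := ω⁻¹ • R t + (ω ^ 3)⁻¹ • R x + (ω ^ 5)⁻¹ • R y

/-- The Dirac operator `D̸(f₁, f₂) = (−D₀f₁ + D₂f₂, D₁f₁ − D₀f₂)` on `F × F`. -/
def Dir : Module.End ℂ (F × F) :=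
  LinearMap.prod (D₂ ∘ₗ LinearMap.snd ℂ F F - D₀ ∘ₗ LinearMap.fst ℂ F F)
    (D₁ ∘ₗ LinearMap.fst ℂ F F - D₀ ∘ₗ LinearMap.snd ℂ F F)

/-- The sign character `χ` of `D₆`: `χ(rᵏ) = 1`, `χ(s·rᵏ) = −1`. -/
def χ : F := fun g => match g with
  | DihedralGroup.r _ => 1
  | DihedralGroup.sr _ => -1

/-- `M_χ`: pointwise multiplication by `χ` in both components of `F × F`. -/
def Mχ : Module.End ℂ (F × F) := (LinearMap.mulLeft ℂ χ).prodMap (LinearMap.mulLeft ℂ χ)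

theorem χ_mul (g h : D6) : χ (g * h) = χ g * χ h := by
  cases g <;> cases h <;> simp [χ]

theorem χ_mul_self : χ * χ = 1 := by
  funext g
  cases g <;> simp [χ]

theorem χ_t : χ t = -1 := by
  simp [χ, t, s, rot]

theorem χ_x : χ x = -1 := by
  simp [χ, x, s, rot]

theorem χ_y : χ y = -1 := by
  simp [χ, y, s, rot]

/-- Right translation by `a` commutes with multiplication by `χ` up to the sign `χ a`. -/
theorem R_χ_mul (a : D6) (f : F) : R a (χ * f) = χ a • (χ * R a f) := by
  funext g
  simp only [R, LinearMap.funLeft_apply, Pi.mul_apply, Pi.smul_apply, smul_eq_mul, χ_mul]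
  ring

theorem D₀_χ_mul (f : F) : D₀ (χ * f) = -(χ * D₀ f) := by
  simp only [D₀, LinearMap.add_apply, R_χ_mul, χ_t, χ_x, χ_y, neg_one_smul, mul_add]
  abel

theorem D₁_χ_mul (f : F) : D₁ (χ * f) = -(χ * D₁ f) := by
  simp only [D₁, LinearMap.add_apply, LinearMap.smul_apply, R_χ_mul, χ_t, χ_x, χ_y,
    neg_one_smul, mul_add, mul_smul_comm, smul_neg]
  abel

theorem D₂_χ_mul (f : F) : D₂ (χ * f) = -(χ * D₂ f) := by
  simp only [D₂, LinearMap.add_apply, LinearMap.smul_apply, R_χ_mul, χ_t, χ_x, χ_y,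
    neg_one_smul, mul_add, mul_smul_comm, smul_neg]
  abel

theorem Mχ_apply (v : F × F) : Mχ v = (χ * v.1, χ * v.2) := rfl

theorem Dir_apply (v : F × F) : Dir v = (D₂ v.2 - D₀ v.1, D₁ v.1 - D₀ v.2) := rfl

theorem Mχ_mul_self : Mχ * Mχ = 1 := by
  refine LinearMap.ext fun v => ?_
  simp [Mχ_apply, ← mul_assoc, χ_mul_self]

theorem Dir_mul_Mχ : Dir * Mχ = -(Mχ * Dir) := by
  refine LinearMap.ext fun v => ?_
  simp only [Module.End.mul_apply, LinearMap.neg_apply, Mχ_apply, Dir_apply, D₀_χ_mul, D₁_χ_mul,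
    D₂_χ_mul, Prod.neg_mk, mul_sub]
  congr 1 <;> abel

/-- An operator anticommuting with `T` maps the `μ`-eigenspace of `T` into the `-μ`-eigenspace. -/
theorem mapsTo_eigenspace_neg {K V : Type*} [CommRing K] [AddCommGroup V] [Module K V]
    {T M : Module.End K V} (h : T * M = -(M * T)) (μ : K) :
    Set.MapsTo M (Module.End.eigenspace T μ) (Module.End.eigenspace T (-μ)) := by
  intro v hv
  rw [SetLike.mem_coe, Module.End.mem_eigenspace_iff] at hv ⊢
  have hTM : T (M v) = -(M (T v)) := LinearMap.congr_fun h v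
  rw [hTM, hv, map_smul, neg_smul]

/-- An involution anticommuting with `T` restricts to a bijection from the `μ`-eigenspace of `T`
onto the `-μ`-eigenspace. -/
theorem bijOn_eigenspace_neg {K V : Type*} [CommRing K] [AddCommGroup V] [Module K V]
    {T M : Module.End K V} (hM : M * M = 1) (h : T * M = -(M * T)) (μ : K) :
    Set.BijOn M (Module.End.eigenspace T μ) (Module.End.eigenspace T (-μ)) := by
  have hinv : Function.LeftInverse M M := fun v => LinearMap.congr_fun hM v
  have hback := mapsTo_eigenspace_neg h (-μ)
  rw [neg_neg] at hback
  exact Set.InvOn.bijOn ⟨hinv.leftInvOn _, hinv.leftInvOn _⟩ (mapsTo_eigenspace_neg h μ) hback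

/-- `M_χ² = id` and `D̸ ∘ M_χ = −M_χ ∘ D̸`; consequently `M_χ` maps the `λ`-eigenspace of
`D̸` bijectively onto the `(−λ)`-eigenspace of `D̸`, for every `λ ∈ ℂ`. -/
theorem conjugation_by_sign_character :
    Mχ * Mχ = 1 ∧ Dir * Mχ = -(Mχ * Dir) ∧
    ∀ lam : ℂ, Set.BijOn ⇑Mχ ↑(Module.End.eigenspace Dir lam)
      ↑(Module.End.eigenspace Dir (-lam)) := by
  exact ⟨Mχ_mul_self, Dir_mul_Mχ, bijOn_eigenspace_neg Mχ_mul_self Dir_mul_Mχ⟩
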